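/- Let M be a connected finite simple graph with a vertex u of degree 4 in M such that all neighbors of u in M have degree two, let u₂ be a neighbor of u in M, let H be the graph obtained from M by attaching a path P_a (a ≥ 1, on a new vertices) to u, and let u′ be the pendent end-vertex of the attached path. Let H′ = H − uu₂ + u′u₂ (delete the edge uu₂ and add the edge u′u₂). Then χ(H′) > χ(H). -/

import Mathlib

open SimpleGraph

/-- The degree of a vertex (stated via `Set.ncard`, so no decidability assumptions). -/
noncomputable def degR {V : Type*} (G : SimpleGraph V) (v : V) : ℕ :=
  (G.neighborSet v).ncard

/-- The sum-connectivity index `χ(G) = ∑_{uv ∈ E(G)} 1/√(d_G(u)+d_G(v))`. -/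
noncomputable def sumConn {V : Type*} [Fintype V] (G : SimpleGraph V) : ℝ :=
  ∑ e ∈ G.edgeSet.toFinite.toFinset,
    Sym2.lift ⟨fun u v => (1 : ℝ) / Real.sqrt ((degR G u : ℝ) + (degR G v : ℝ)),
      fun u v => by simp [add_comm]⟩ e

/-- The graph obtained from `M` by attaching a path `P_a` on `a` new vertices to `u`:
the path vertex `Sum.inr ⟨0,_⟩` is joined to `u` by an edge, the path consists of the
edges between consecutive new vertices, and `Sum.inr ⟨a-1,_⟩` is the pendent
end-vertex of the attached path. -/
def attachPath {W : Type*} (M : SimpleGraph W) (u : W) (a : ℕ) :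
    SimpleGraph (W ⊕ Fin a) :=
  SimpleGraph.fromRel (fun x y =>
    (∃ w w', x = Sum.inl w ∧ y = Sum.inl w' ∧ M.Adj w w') ∨
    (∃ h : 0 < a, x = Sum.inl u ∧ y = Sum.inr ⟨0, h⟩) ∨
    (∃ i j : Fin a, x = Sum.inr i ∧ y = Sum.inr j ∧ (j : ℕ) = (i : ℕ) + 1))

section EdgeTransfer

variable {V : Type*}

/-- The graph `G - xy + py`. -/
private abbrev moveEdge (G : SimpleGraph V) (x y p : V) : SimpleGraph V :=
  G.deleteEdges {s(x, y)} ⊔ SimpleGraph.fromEdgeSet {s(p, y)}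

/-- The contribution of a pair of vertices to the sum-connectivity index. -/
private noncomputable abbrev weight (G : SimpleGraph V) (e : Sym2 V) : ℝ :=
  Sym2.lift ⟨fun u v => (1 : ℝ) / Real.sqrt ((degR G u : ℝ) + (degR G v : ℝ)),
    fun u v => by simp [add_comm]⟩ e

private lemma one_div_sqrt_le {r s : ℝ} (hr : 0 < r) (h : r ≤ s) :
    1 / Real.sqrt s ≤ 1 / Real.sqrt r :=
  one_div_le_one_div_of_le (Real.sqrt_pos.2 hr) (Real.sqrt_le_sqrt h)

private lemma degR_pos [Finite V] {G : SimpleGraph V} {v w : V} (h : G.Adj v w) :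
    0 < degR G v :=
  (Set.ncard_pos (Set.toFinite _)).2 ⟨w, h⟩

private lemma one_div_sqrt_four : 1 / Real.sqrt 4 = (1 / 2 : ℝ) := by
  rw [show (4 : ℝ) = 2 ^ 2 by norm_num, Real.sqrt_sq (by norm_num)]

private lemma one_div_sqrt_seven_lt : 1 / Real.sqrt 7 < (2 / 5 : ℝ) := by
  rw [one_div_lt (Real.sqrt_pos.2 (by norm_num)) (by norm_num)]
  exact Real.lt_sqrt_of_sq_lt (by norm_num)

private lemma one_div_sqrt_three_lt : 1 / Real.sqrt 3 < (3 / 5 : ℝ) := by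
  rw [one_div_lt (Real.sqrt_pos.2 (by norm_num)) (by norm_num)]
  exact Real.lt_sqrt_of_sq_lt (by norm_num)

private lemma degR_moveEdge_of_ne [Finite V] (G : SimpleGraph V) {x y p v : V}
    (hv : v ≠ p) (hxy : G.Adj x y) : degR (moveEdge G x y p) v ≤ degR G v := by
  by_cases hvy : v = y
  · subst hvy
    calc degR (moveEdge G x v p) v
        ≤ (insert p (G.neighborSet v \ {x})).ncard := by
          refine Set.ncard_le_ncard ?_ (Set.toFinite _)
          intro z hz
          simp only [mem_neighborSet, sup_adj, deleteEdges_adj, fromEdgeSet_adj,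
            Set.mem_singleton_iff, Sym2.eq_iff] at hz
          simp only [Set.mem_insert_iff, Set.mem_sdiff, mem_neighborSet, Set.mem_singleton_iff]
          grind
      _ ≤ (G.neighborSet v \ {x}).ncard + 1 := Set.ncard_insert_le _ _
      _ = degR G v := Set.ncard_sdiff_singleton_add_one hxy.symm (Set.toFinite _)
  · refine Set.ncard_le_ncard ?_ (Set.toFinite _)
    intro z hz
    simp only [mem_neighborSet, sup_adj, deleteEdges_adj, fromEdgeSet_adj,
      Set.mem_singleton_iff, Sym2.eq_iff] at hz
    simp only [mem_neighborSet]
    grind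

private lemma degR_moveEdge_lt [Finite V] (G : SimpleGraph V) {x y p : V}
    (hpx : p ≠ x) (hxy : G.Adj x y) : degR (moveEdge G x y p) x < degR G x := by
  refine Set.ncard_lt_ncard ?_ (Set.toFinite _)
  have hne := hxy.ne
  refine ⟨?_, fun h => ?_⟩
  · intro z hz
    simp only [mem_neighborSet, sup_adj, deleteEdges_adj, fromEdgeSet_adj,
      Set.mem_singleton_iff, Sym2.eq_iff] at hz
    simp only [mem_neighborSet]
    grind
  · have hz := h hxy
    simp only [mem_neighborSet, sup_adj, deleteEdges_adj, fromEdgeSet_adj,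
      Set.mem_singleton_iff, Sym2.eq_iff] at hz
    grind

private lemma degR_moveEdge_self_le [Finite V] (G : SimpleGraph V) (x y p : V) :
    degR (moveEdge G x y p) p ≤ degR G p + 1 := by
  refine (Set.ncard_le_ncard (t := insert y (G.neighborSet p)) ?_ (Set.toFinite _)).trans
    (Set.ncard_insert_le _ _)
  intro z hz
  simp only [mem_neighborSet, sup_adj, deleteEdges_adj, fromEdgeSet_adj,
    Set.mem_singleton_iff, Sym2.eq_iff] at hz
  simp only [Set.mem_insert_iff, mem_neighborSet]
  grind

private lemma sumConn_eq_sum_weight [Fintype V] (G : SimpleGraph V) :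
    sumConn G = ∑ e ∈ G.edgeSet.toFinite.toFinset, weight G e := rfl

private lemma weight_le_of_degR_add_le [Finite V] {G G' : SimpleGraph V} {v w : V}
    (h : G'.Adj v w) (hle : degR G' v + degR G' w ≤ degR G v + degR G w) :
    weight G s(v, w) ≤ weight G' s(v, w) := by
  refine one_div_sqrt_le ?_ (by exact_mod_cast hle)
  exact_mod_cast Nat.add_pos_left (degR_pos h) _

/-- Moving an edge from a vertex `x` of degree five to a pendent vertex `p` increases the
sum-connectivity index. -/
private lemma sumConn_lt_moveEdge [Fintype V] (G : SimpleGraph V) {x y p q : V}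
    (hpx : p ≠ x) (hpy : p ≠ y) (hqy : q ≠ y) (hxy : G.Adj x y)
    (hx : degR G x = 5) (hy : degR G y = 2) (hp : G.neighborSet p = {q})
    (hq : q = x ∨ degR G q = 2) :
    sumConn G < sumConn (moveEdge G x y p) := by
  classical
  have hadj (z : V) : G.Adj p z ↔ z = q := by
    rw [← mem_neighborSet, hp, Set.mem_singleton_iff]
  have hdp : degR G p = 1 := by rw [degR, hp, Set.ncard_singleton]
  set G' := moveEdge G x y p with hG'
  have hdp' : degR G' p ≤ 2 := (degR_moveEdge_self_le G x y p).trans_eq (by rw [hdp])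
  have hdy' : degR G' y ≤ 2 := hy ▸ degR_moveEdge_of_ne G hpy.symm hxy
  have hG'py : G'.Adj p y := by simp [hG', hpy]
  have hG'pq : G'.Adj p q := by simp [hG', hadj, hpx, hpy]
  set R := G.edgeSet.toFinite.toFinset.erase s(x, y) with hR
  have hE : G.edgeSet.toFinite.toFinset = insert s(x, y) R := by
    rw [hR, Finset.insert_erase]; simpa using hxy
  have hE' : G'.edgeSet.toFinite.toFinset = insert s(p, y) R := by
    ext e
    induction e using Sym2.ind with
    | _ v w =>
      simp only [hG', hR, Set.Finite.mem_toFinset, mem_edgeSet, sup_adj, deleteEdges_adj,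
        fromEdgeSet_adj, Set.mem_singleton_iff, Finset.mem_insert, Finset.mem_erase, Sym2.eq_iff]
      grind
  have hmem {e : Sym2 V} (he : e ∈ R) : e ∈ G'.edgeSet := by
    rw [← Set.Finite.mem_toFinset G'.edgeSet.toFinite, hE']
    exact Finset.mem_insert_of_mem he
  have hxyR : s(x, y) ∉ R := by simp [hR]
  have hpyR : s(p, y) ∉ R := by simp [hR, hadj, hqy.symm]
  have hpqR : s(p, q) ∈ R := by
    simp [hR, hadj, hpx, hpy]
  have hwxy : weight G s(x, y) < 2 / 5 := by
    simp only [weight, Sym2.lift_mk, hx, hy]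
    norm_num only [Nat.cast_ofNat]
    exact one_div_sqrt_seven_lt
  have half_le {v w : V} (h : G'.Adj v w) (hv : degR G' v ≤ 2) (hw : degR G' w ≤ 2) :
      1 / 2 ≤ weight G' s(v, w) := by
    rw [← one_div_sqrt_four]
    refine one_div_sqrt_le ?_ ?_
    · exact_mod_cast Nat.add_pos_left (degR_pos h) _
    · exact_mod_cast (by omega : degR G' v + degR G' w ≤ 4)
  have hwpy := half_le hG'py hdp' hdy'
  have hrest : ∑ e ∈ R.erase s(p, q), weight G e ≤ ∑ e ∈ R.erase s(p, q), weight G' e := by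
    refine Finset.sum_le_sum fun e he => ?_
    rw [Finset.mem_erase] at he
    have hGe : e ∈ G.edgeSet := by
      simpa using Finset.mem_of_mem_erase he.2
    have hG'e := hmem he.2
    induction e using Sym2.ind with
    | _ v w =>
      rw [mem_edgeSet] at hGe hG'e
      have hv : v ≠ p := by
        rintro rfl
        exact he.1 (by rw [(hadj w).1 hGe])
      have hw : w ≠ p := by
        rintro rfl
        exact he.1 (by rw [(hadj v).1 hGe.symm, Sym2.eq_swap])
      exact weight_le_of_degR_add_le hG'e
        (add_le_add (degR_moveEdge_of_ne G hv hxy) (degR_moveEdge_of_ne G hw hxy))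
  have hpq : weight G s(p, q) - 1 / 10 ≤ weight G' s(p, q) := by
    rcases hq with rfl | hq
    · have hlt : degR G' q < degR G q := degR_moveEdge_lt G hpx hxy
      have := weight_le_of_degR_add_le (G := G) hG'pq (by omega)
      linarith
    · have hqp : q ≠ p := hG'pq.ne'
      have h1 := half_le hG'pq hdp' (hq ▸ degR_moveEdge_of_ne G hqp hxy)
      have h2 : weight G s(p, q) < 3 / 5 := by
        simp only [weight, Sym2.lift_mk, hdp, hq]
        norm_num only [Nat.cast_ofNat, Nat.cast_one]
        exact one_div_sqrt_three_lt
      linarith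
  rw [sumConn_eq_sum_weight, sumConn_eq_sum_weight, hE, hE', Finset.sum_insert hxyR,
    Finset.sum_insert hpyR, ← Finset.add_sum_erase R _ hpqR, ← Finset.add_sum_erase R _ hpqR]
  linarith

end EdgeTransfer

section AttachPath

variable {W : Type*} (M : SimpleGraph W) (u : W) {a : ℕ}

private lemma attachPath_adj_inl_inl (v w : W) :
    (attachPath M u a).Adj (Sum.inl v) (Sum.inl w) ↔ M.Adj v w := by
  simp only [attachPath, fromRel_adj]
  have (h : M.Adj v w) : v ≠ w := h.ne
  simp [M.adj_comm w v]
  grind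

private lemma attachPath_adj_inl_inr (v : W) (i : Fin a) :
    (attachPath M u a).Adj (Sum.inl v) (Sum.inr i) ↔ v = u ∧ (i : ℕ) = 0 := by
  have := i.2
  simp [attachPath, Fin.ext_iff]
  omega

private lemma attachPath_adj_inr_inl (v : W) (i : Fin a) :
    (attachPath M u a).Adj (Sum.inr i) (Sum.inl v) ↔ v = u ∧ (i : ℕ) = 0 := by
  rw [adj_comm, attachPath_adj_inl_inr]

private lemma attachPath_adj_inr_inr (i j : Fin a) :
    (attachPath M u a).Adj (Sum.inr i) (Sum.inr j) ↔
      (j : ℕ) = i + 1 ∨ (i : ℕ) = j + 1 := by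
  simp [attachPath, Fin.ext_iff, -exists_and_left]
  grind

private lemma degR_attachPath_inl_of_ne {v : W} (hv : v ≠ u) :
    degR (attachPath M u a) (Sum.inl v) = degR M v := by
  have h : (attachPath M u a).neighborSet (Sum.inl v) = Sum.inl '' M.neighborSet v := by
    ext (z | i) <;> simp [attachPath_adj_inl_inl, attachPath_adj_inl_inr, hv]
  rw [degR, h, Set.ncard_image_of_injective _ Sum.inl_injective, degR]

private lemma degR_attachPath_inl_self [Finite W] (ha : 0 < a) :
    degR (attachPath M u a) (Sum.inl u) = degR M u + 1 := by
  have h : (attachPath M u a).neighborSet (Sum.inl u) =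
      insert (Sum.inr ⟨0, ha⟩) (Sum.inl '' M.neighborSet u) := by
    ext (z | i) <;> simp [attachPath_adj_inl_inl, attachPath_adj_inl_inr, Fin.ext_iff]
  rw [degR, h, Set.ncard_insert_of_notMem (by simp) (Set.toFinite _),
    Set.ncard_image_of_injective _ Sum.inl_injective, degR]

/-- The last vertex of the attached path has exactly one neighbor, which is either `u` or an
inner path vertex of degree two. -/
private lemma exists_neighborSet_attachPath_last (ha : 1 ≤ a) :
    ∃ q, (attachPath M u a).neighborSet (Sum.inr ⟨a - 1, Nat.sub_lt ha Nat.one_pos⟩) = {q} ∧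
      (q = Sum.inl u ∨ ∃ i, q = Sum.inr i ∧ degR (attachPath M u a) q = 2) := by
  rcases Nat.lt_or_ge 1 a with h1 | h1
  · refine ⟨Sum.inr ⟨a - 2, by omega⟩, ?_, Or.inr ⟨_, rfl, ?_⟩⟩
    · ext (z | i)
      · simp [attachPath_adj_inr_inl]; omega
      · have := i.2
        simp [attachPath_adj_inr_inr, Fin.ext_iff]; omega
    · rcases Nat.lt_or_ge 2 a with h2 | h2
      · rw [degR, Set.ncard_eq_two]
        refine ⟨Sum.inr ⟨a - 3, by omega⟩, Sum.inr ⟨a - 1, by omega⟩,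
          by simp [Fin.ext_iff]; omega, ?_⟩
        ext (z | i)
        · simp [attachPath_adj_inr_inl]; omega
        · have := i.2
          simp [attachPath_adj_inr_inr, Fin.ext_iff]; omega
      · rw [degR, Set.ncard_eq_two]
        refine ⟨Sum.inl u, Sum.inr ⟨a - 1, by omega⟩, by simp, ?_⟩
        ext (z | i)
        · simp [attachPath_adj_inr_inl]; omega
        · have := i.2
          simp [attachPath_adj_inr_inr, Fin.ext_iff]; omega
  · refine ⟨Sum.inl u, ?_, Or.inl rfl⟩
    ext (z | i)
    · simp [attachPath_adj_inr_inl]; omega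
    · have := i.2
      simp [attachPath_adj_inr_inr]; omega

end AttachPath

/-- Let `M` be a connected graph, `u` a vertex of degree `4` in `M` all of whose
neighbors have degree two, and `u₂` a neighbor of `u`. Let `H` be obtained from `M` by
attaching a path `P_a` (`a ≥ 1`) to `u`, with pendent end-vertex `u′` of the attached
path, and let `H′ = H − uu₂ + u′u₂`. Then `χ(H′) > χ(H)`. -/
theorem stmt_15 {W : Type*} [Fintype W] (M : SimpleGraph W) (hconn : M.Connected)
    (u u₂ : W) (h2 : M.Adj u u₂) (hdeg : degR M u = 4)
    (hnbr : ∀ w : W, M.Adj u w → degR M w = 2)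
    (a : ℕ) (ha : 1 ≤ a) :
    sumConn ((attachPath M u a).deleteEdges {s(Sum.inl u, Sum.inl u₂)} ⊔
        SimpleGraph.fromEdgeSet
          {s(Sum.inr (⟨a - 1, Nat.sub_lt ha Nat.one_pos⟩ : Fin a), Sum.inl u₂)}) >
      sumConn (attachPath M u a) := by
  obtain ⟨q, hp, hq⟩ := exists_neighborSet_attachPath_last M u ha
  have hx : degR (attachPath M u a) (Sum.inl u) = 5 := by
    rw [degR_attachPath_inl_self M u ha, hdeg]
  have hy : degR (attachPath M u a) (Sum.inl u₂) = 2 := by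
    rw [degR_attachPath_inl_of_ne M u h2.ne', hnbr u₂ h2]
  refine sumConn_lt_moveEdge (attachPath M u a) (q := q) (by simp) (by simp) ?_
    ((attachPath_adj_inl_inl M u u u₂).2 h2) hx hy hp (hq.imp_right fun ⟨_, _, h⟩ => h)
  rcases hq with rfl | ⟨i, rfl, -⟩
  · simpa using h2.ne
  · simp
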